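/- arXiv:2512.19334 — 10 statements merged into one kernel-verified Lean document; each statement's English description precedes it below -/
import Mathlib

section
/- Let μ be a Borel probability measure on ℝ with compact support contained in [0,∞), let δ ∈ (0,1] and θ > 0, and let S_μ, C, Γ be as in the context, viewed as functions of a real variable on ℝ \ supp(μ). If λ ∈ ℝ \ supp(μ) satisfies Γ(λ) = 0, then S_μ(λ) ≠ 0, the real derivatives C'(λ) and Γ'(λ) exist, Γ'(λ) ≠ 0, and Γ'(λ) has the same sign as S_μ(λ); equivalently, C'(λ) has the sign opposite to that of S_μ(λ). -/
open MeasureTheory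

/-- The topological support of a Borel measure on `ℝ`: the set of points all of whose
open neighborhoods have positive measure. -/
def measSupport (μ : Measure ℝ) : Set ℝ :=
  {x : ℝ | ∀ U : Set ℝ, IsOpen U → x ∈ U → 0 < μ U}

/-- Almost every point of a Borel measure on `ℝ` lies in its support. -/
theorem ae_mem_measSupport (μ : Measure ℝ) : ∀ᵐ t ∂μ, t ∈ measSupport μ := by
  refine measure_null_of_locally_null _ fun x hx => ?_
  simp only [measSupport, Set.mem_compl_iff, Set.mem_ofPred_eq, not_forall, not_lt,
    nonpos_iff_eq_zero] at hx
  obtain ⟨U, hU, hxU, h0⟩ := hx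
  exact ⟨U, mem_nhdsWithin_of_mem_nhds (hU.mem_nhds hxU), h0⟩

/-- A point off the support has positive distance to almost every point. -/
theorem exists_pos_ae_le_abs_sub {μ : Measure ℝ} {x : ℝ} (hx : x ∉ measSupport μ) :
    ∃ ε > 0, ∀ᵐ t ∂μ, ε ≤ |x - t| := by
  simp only [measSupport, Set.mem_ofPred_eq, not_forall, not_lt, nonpos_iff_eq_zero] at hx
  obtain ⟨U, hU, hxU, h0⟩ := hx
  obtain ⟨ε, hε, hball⟩ := Metric.isOpen_iff.mp hU x hxU
  refine ⟨ε, hε, measure_mono_null (fun t ht => hball ?_) h0⟩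
  rw [Metric.mem_ball, dist_comm, Real.dist_eq]
  exact not_le.mp ht

section StieltjesTransform

variable {μ : Measure ℝ} [IsFiniteMeasure μ] {x ε : ℝ}

theorem integrable_inv_sub (hε : 0 < ε) (h : ∀ᵐ t ∂μ, ε ≤ |x - t|) :
    Integrable (fun t : ℝ => (x - t)⁻¹) μ := by
  refine Integrable.of_bound (C := ε⁻¹) (by fun_prop) ?_
  filter_upwards [h] with t ht
  rw [norm_inv, Real.norm_eq_abs]
  exact inv_anti₀ hε ht

theorem integrable_inv_sub_sq (hε : 0 < ε) (h : ∀ᵐ t ∂μ, ε ≤ |x - t|) :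
    Integrable (fun t : ℝ => ((x - t)⁻¹) ^ 2) μ := by
  refine Integrable.of_bound (C := (ε⁻¹) ^ 2) (by fun_prop) ?_
  filter_upwards [h] with t ht
  rw [norm_pow, norm_inv, Real.norm_eq_abs]
  gcongr

theorem hasDerivAt_integral_inv_sub (hε : 0 < ε) (h : ∀ᵐ t ∂μ, ε ≤ |x - t|) :
    HasDerivAt (fun y : ℝ => ∫ t : ℝ, (y - t)⁻¹ ∂μ) (-∫ t : ℝ, ((x - t)⁻¹) ^ 2 ∂μ) x := by
  have hfar : ∀ᵐ t ∂μ, ∀ y ∈ Metric.ball x (ε / 2), ε / 2 ≤ |y - t| := by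
    filter_upwards [h] with t ht y hy
    rw [Metric.mem_ball, dist_comm, Real.dist_eq] at hy
    linarith [abs_sub_le x y t]
  rw [← integral_neg]
  refine (hasDerivAt_integral_of_dominated_loc_of_deriv_le
    (F' := fun y t => -((y - t)⁻¹) ^ 2) (bound := fun _ => ((ε / 2)⁻¹) ^ 2)
    (Metric.ball_mem_nhds x (half_pos hε)) (.of_forall fun y => by fun_prop)
    (integrable_inv_sub hε h) (by fun_prop) ?_ (integrable_const _) ?_).2
  · filter_upwards [hfar] with t ht y hy
    have := ht y hy
    rw [norm_neg, norm_pow, norm_inv, Real.norm_eq_abs]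
    gcongr
  · filter_upwards [hfar] with t ht y hy
    have hne : y - t ≠ 0 := abs_pos.mp ((half_pos hε).trans_le (ht y hy))
    refine (((hasDerivAt_id y).sub_const t).inv hne).congr_deriv ?_
    simp [neg_div]

/-- For a measure on `[0, ∞)`, the derivative `S + x S'` of `x S` is nonpositive. -/
theorem integral_inv_sub_le_mul (hε : 0 < ε) (h : ∀ᵐ t ∂μ, ε ≤ |x - t|)
    (hpos : ∀ᵐ t ∂μ, 0 ≤ t) :
    ∫ t : ℝ, (x - t)⁻¹ ∂μ ≤ x * ∫ t : ℝ, ((x - t)⁻¹) ^ 2 ∂μ := by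
  rw [← integral_const_mul]
  refine integral_mono_ae (integrable_inv_sub hε h) ((integrable_inv_sub_sq hε h).const_mul x) ?_
  filter_upwards [h, hpos] with t ht ht0
  have hne : x - t ≠ 0 := abs_pos.mp (hε.trans_le ht)
  have key : x * ((x - t)⁻¹) ^ 2 - (x - t)⁻¹ = t * ((x - t)⁻¹) ^ 2 := by
    field_simp
    ring
  have : 0 ≤ t * ((x - t)⁻¹) ^ 2 := by positivity
  linarith

theorem integral_inv_sub_sq_pos (hε : 0 < ε) (h : ∀ᵐ t ∂μ, ε ≤ |x - t|)
    (hS : ∫ t : ℝ, (x - t)⁻¹ ∂μ ≠ 0) : 0 < ∫ t : ℝ, ((x - t)⁻¹) ^ 2 ∂μ := by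
  refine (integral_nonneg fun t => sq_nonneg _).lt_of_ne' fun h0 => hS ?_
  rw [integral_eq_zero_iff_of_nonneg (fun t => sq_nonneg _) (integrable_inv_sub_sq hε h)] at h0
  refine integral_eq_zero_of_ae ?_
  filter_upwards [h0] with t ht
  exact pow_eq_zero_iff two_ne_zero |>.mp ht

end StieltjesTransform

theorem stmt_1 (μ : Measure ℝ) [IsProbabilityMeasure μ]
    (hcpt : IsCompact (measSupport μ)) (hpos : measSupport μ ⊆ Set.Ici (0 : ℝ))
    (δ θ : ℝ) (hδ : δ ∈ Set.Ioc (0 : ℝ) 1) (hθ : 0 < θ)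
    (S C Γ : ℝ → ℝ)
    (hS : ∀ x : ℝ, S x = ∫ t : ℝ, (x - t)⁻¹ ∂μ)
    (hC : ∀ x : ℝ, C x = δ * x * (S x) ^ 2 + (1 - δ) * S x)
    (hΓ : ∀ x : ℝ, Γ x = 1 - θ ^ 2 * C x)
    (lam : ℝ) (hlam : lam ∉ measSupport μ) (hroot : Γ lam = 0) :
    S lam ≠ 0 ∧
      DifferentiableAt ℝ C lam ∧ DifferentiableAt ℝ Γ lam ∧
      deriv Γ lam ≠ 0 ∧
      Real.sign (deriv Γ lam) = Real.sign (S lam) ∧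
      Real.sign (deriv C lam) = - Real.sign (S lam) := by
  obtain ⟨ε, hε, hfar⟩ := exists_pos_ae_le_abs_sub hlam
  have hnonneg : ∀ᵐ t ∂μ, 0 ≤ t := (ae_mem_measSupport μ).mono fun t ht => hpos ht
  have hSd := hasDerivAt_integral_inv_sub hε hfar
  have hle := integral_inv_sub_le_mul hε hfar hnonneg
  have hIpos := integral_inv_sub_sq_pos hε hfar
  rw [← funext hS] at hSd
  rw [← hS] at hle hIpos
  set I := ∫ t : ℝ, ((lam - t)⁻¹) ^ 2 ∂μ
  set Q := δ * lam * S lam + (1 - δ) with hQ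
  have hprod : 0 < S lam * Q := by
    have h1 : θ ^ 2 * (S lam * Q) = 1 := by
      rw [hΓ, hC] at hroot
      rw [hQ]
      linear_combination -hroot
    exact pos_of_mul_pos_right (h1 ▸ one_pos) (sq_nonneg θ)
  have hS0 : S lam ≠ 0 := left_ne_zero_of_mul hprod.ne'
  have hI := hIpos hS0
  have hCd : HasDerivAt C (δ * S lam * (S lam - lam * I) - Q * I) lam := by
    rw [funext hC]
    refine ((((hasDerivAt_id lam).const_mul δ).mul (hSd.pow 2)).add
      (hSd.const_mul (1 - δ))).congr_deriv ?_
    simp only [hQ, id, Nat.cast_ofNat, Pi.pow_apply]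
    ring
  have hΓd : HasDerivAt Γ (-(θ ^ 2 * (δ * S lam * (S lam - lam * I) - Q * I))) lam := by
    rw [funext hΓ]
    exact (hCd.const_mul _).const_sub 1
  refine ⟨hS0, hCd.differentiableAt, hΓd.differentiableAt, ?_⟩
  rw [hΓd.deriv, hCd.deriv]
  have hθ2 : 0 < θ ^ 2 := by positivity
  have hδ0 : 0 < δ := hδ.1
  rcases hS0.lt_or_gt with hneg | hpos'
  · have hQneg : Q < 0 := neg_of_mul_pos_right hprod hneg.le
    have hder : 0 < δ * S lam * (S lam - lam * I) - Q * I := by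
      have h1 := mul_nonneg_of_nonpos_of_nonpos
        (mul_nonpos_of_nonneg_of_nonpos hδ0.le hneg.le) (sub_nonpos.mpr hle)
      have h2 := mul_neg_of_neg_of_pos hQneg hI
      linarith
    have hΓneg := neg_neg_of_pos (mul_pos hθ2 hder)
    refine ⟨hΓneg.ne, ?_, ?_⟩
    · rw [Real.sign_of_neg hΓneg, Real.sign_of_neg hneg]
    · rw [Real.sign_of_pos hder, Real.sign_of_neg hneg, neg_neg]
  · have hQpos : 0 < Q := pos_of_mul_pos_right hprod hpos'.le
    have hder : δ * S lam * (S lam - lam * I) - Q * I < 0 := by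
      have h1 := mul_nonpos_of_nonneg_of_nonpos (mul_pos hδ0 hpos').le (sub_nonpos.mpr hle)
      have h2 := mul_pos hQpos hI
      linarith
    have hΓpos := neg_pos.mpr (mul_neg_of_pos_of_neg hθ2 hder)
    refine ⟨hΓpos.ne', ?_, ?_⟩
    · rw [Real.sign_of_pos hΓpos, Real.sign_of_pos hpos']
    · rw [Real.sign_of_neg hder, Real.sign_of_pos hpos']
end

section
/- Let θ > 0, δ ∈ (0,1], λ > 0, m > 0 and h be real numbers, and let π denote the real number pi. Define A := 1 − δ·θ²·π²·λ·h² + δ·θ²·π²·λ·m² − (1−δ)·θ²·π·h and B := π·θ²·m·((1−δ) + 2·δ·π·λ·h). If B = 0, then A = 1 + θ²·(1−δ)²/(4·δ·λ) + δ·θ²·π²·λ·m², and in particular A > 0. -/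
theorem stmt_3 (θ δ lam m h : ℝ) (hθ : 0 < θ) (hδ : δ ∈ Set.Ioc (0 : ℝ) 1)
    (hlam : 0 < lam) (hm : 0 < m)
    (A B : ℝ)
    (hA : A = 1 - δ * θ ^ 2 * Real.pi ^ 2 * lam * h ^ 2
        + δ * θ ^ 2 * Real.pi ^ 2 * lam * m ^ 2 - (1 - δ) * θ ^ 2 * Real.pi * h)
    (hB : B = Real.pi * θ ^ 2 * m * ((1 - δ) + 2 * δ * Real.pi * lam * h))
    (hB0 : B = 0) :
    A = 1 + θ ^ 2 * (1 - δ) ^ 2 / (4 * δ * lam) + δ * θ ^ 2 * Real.pi ^ 2 * lam * m ^ 2 ∧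
      0 < A := by
  have hδ0 : 0 < δ := hδ.1
  have hpi : 0 < Real.pi := Real.pi_pos
  have hfactor : (1 - δ) + 2 * δ * Real.pi * lam * h = 0 :=
    (mul_eq_zero.mp (hB.symm.trans hB0)).resolve_left (by positivity)
  have hsub : 1 - δ = -(2 * δ * Real.pi * lam * h) := by linarith
  have hAeq : A = 1 + θ ^ 2 * (1 - δ) ^ 2 / (4 * δ * lam)
      + δ * θ ^ 2 * Real.pi ^ 2 * lam * m ^ 2 := by
    rw [hA, hsub]
    field_simp
    ring
  refine ⟨hAeq, ?_⟩
  rw [hAeq]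
  positivity
end

section
/- Let δ ∈ (0,1), set a₋ := (1 − √δ)² and b₊ := (1 + √δ)², and let μ be a Borel probability measure on ℝ with supp(μ) ⊆ [a₋, b₊]. Suppose that the Stieltjes transform S_μ satisfies the Marchenko–Pastur self-consistent equation δ·λ·S_μ(λ)² − (λ + δ − 1)·S_μ(λ) + 1 = 0 for every λ ∈ (0, a₋). Then for every θ > 0 and every λ ∈ [0, a₋), one has Γ(λ) = 1 − θ²·(δ·λ·S_μ(λ)² + (1−δ)·S_μ(λ)) > 1; in particular, the master equation Γ(λ) = 0 has no real solution on [0, a₋). -/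
open MeasureTheory

theorem ae_mem_of_measSupport_subset {μ : Measure ℝ} {s : Set ℝ} (h : measSupport μ ⊆ s) :
    ∀ᵐ t ∂μ, t ∈ s := by
  filter_upwards [Measure.support_mem_ae (μ := μ)] with t ht
  exact h fun U hU htU => (Measure.mem_support_iff_forall t).1 ht U (hU.mem_nhds htU)

theorem integral_inv_sub_neg {μ : Measure ℝ} [IsProbabilityMeasure μ] {a b x : ℝ}
    (h : ∀ᵐ t ∂μ, t ∈ Set.Icc a b) (hx : x < a) : ∫ t : ℝ, (x - t)⁻¹ ∂μ < 0 := by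
  have hab : a ≤ b := by
    obtain ⟨t, ht⟩ := h.exists
    exact ht.1.trans ht.2
  have hint : Integrable (fun t : ℝ => (x - t)⁻¹) μ := by
    refine Integrable.of_bound (C := (a - x)⁻¹) (by fun_prop) ?_
    filter_upwards [h] with t ht
    rw [norm_inv, Real.norm_eq_abs, abs_sub_comm, abs_of_pos (by linarith [ht.1])]
    exact inv_anti₀ (by linarith) (by linarith [ht.1])
  calc ∫ t : ℝ, (x - t)⁻¹ ∂μ ≤ ∫ _ : ℝ, (x - b)⁻¹ ∂μ := by
        refine integral_mono_ae hint (integrable_const _) ?_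
        filter_upwards [h] with t ht
        exact (inv_le_inv_of_neg (by linarith [ht.1]) (by linarith)).2 (by linarith [ht.2])
    _ = (x - b)⁻¹ := by simp
    _ < 0 := inv_lt_zero.2 (by linarith)

theorem stmt_4 (δ : ℝ) (hδ : δ ∈ Set.Ioo (0 : ℝ) 1)
    (aMinus bPlus : ℝ)
    (ha : aMinus = (1 - Real.sqrt δ) ^ 2) (hb : bPlus = (1 + Real.sqrt δ) ^ 2)
    (μ : Measure ℝ) [IsProbabilityMeasure μ]
    (hsupp : measSupport μ ⊆ Set.Icc aMinus bPlus)
    (S : ℝ → ℝ) (hS : ∀ x : ℝ, S x = ∫ t : ℝ, (x - t)⁻¹ ∂μ)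
    (hMP : ∀ lam ∈ Set.Ioo (0 : ℝ) aMinus,
      δ * lam * (S lam) ^ 2 - (lam + δ - 1) * S lam + 1 = 0) :
    ∀ θ : ℝ, 0 < θ → ∀ lam ∈ Set.Ico (0 : ℝ) aMinus,
      1 < 1 - θ ^ 2 * (δ * lam * (S lam) ^ 2 + (1 - δ) * S lam) ∧
      1 - θ ^ 2 * (δ * lam * (S lam) ^ 2 + (1 - δ) * S lam) ≠ 0 := by
  intro θ hθ lam hlam
  have hneg : S lam < 0 := by
    rw [hS]
    exact integral_inv_sub_neg (ae_mem_of_measSupport_subset hsupp) hlam.2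
  have hC : δ * lam * (S lam) ^ 2 + (1 - δ) * S lam < 0 := by
    rcases hlam.1.eq_or_lt with rfl | hpos
    · nlinarith [hδ.2]
    · nlinarith [hMP lam ⟨hpos, hlam.2⟩]
  have hΓ : 1 < 1 - θ ^ 2 * (δ * lam * (S lam) ^ 2 + (1 - δ) * S lam) := by
    linarith [mul_neg_of_pos_of_neg (pow_pos hθ 2) hC]
  exact ⟨hΓ, (one_pos.trans hΓ).ne'⟩
end

section
/- Let δ ∈ (0,1) and θ, ρ₁, ρ₂ > 0 be real numbers. Define a := δ(1+ρ₁)/θ² + 1, b := δ(1+ρ₂)/θ² + δ, λ* := 1 + δ + θ² + δ/θ², and T := ρ₂(1 + δ/θ²) + ρ₁(δ + δ/θ²) + ρ₁ρ₂·δ/θ² + λ*. Let S be a real number satisfying δ·T·S² − (T + δ − 1)·S + 1 = 0 and set X := δ·S + (1−δ)/T. Then S ≠ 0, X ≠ 0, and the coupled system holds: a·X = 1 + (δ/θ²)·(1 − (1 − ρ₁·b·S)/(b·S)) and b·S = 1 + (1/θ²)·(1 − (1 − ρ₂·a·X)/(a·X)). -/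
theorem stmt_5 (δ θ ρ₁ ρ₂ S : ℝ)
    (hδ : δ ∈ Set.Ioo (0 : ℝ) 1) (hθ : 0 < θ) (hρ₁ : 0 < ρ₁) (hρ₂ : 0 < ρ₂)
    (a b lamStar T X : ℝ)
    (ha : a = δ * (1 + ρ₁) / θ ^ 2 + 1)
    (hb : b = δ * (1 + ρ₂) / θ ^ 2 + δ)
    (hlam : lamStar = 1 + δ + θ ^ 2 + δ / θ ^ 2)
    (hT : T = ρ₂ * (1 + δ / θ ^ 2) + ρ₁ * (δ + δ / θ ^ 2) + ρ₁ * ρ₂ * (δ / θ ^ 2) + lamStar)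
    (hquad : δ * T * S ^ 2 - (T + δ - 1) * S + 1 = 0)
    (hX : X = δ * S + (1 - δ) / T) :
    S ≠ 0 ∧ X ≠ 0 ∧
      a * X = 1 + (δ / θ ^ 2) * (1 - (1 - ρ₁ * b * S) / (b * S)) ∧
      b * S = 1 + (1 / θ ^ 2) * (1 - (1 - ρ₂ * a * X) / (a * X)) := by
  obtain ⟨hδ0, hδ1⟩ := hδ
  have ha0 : 0 < a := by rw [ha]; positivity
  have hb0 : 0 < b := by rw [hb]; positivity
  have hT0 : 0 < T := by rw [hT, hlam]; positivity
  have hab : a * b = δ * T / θ ^ 2 := by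
    rw [ha, hb, hT, hlam]
    field_simp
    ring
  have hS0 : S ≠ 0 := by
    rintro rfl
    simp at hquad
  have hTX : T * X = δ * T * S + (1 - δ) := by
    rw [hX]
    field_simp
  have hTXS : T * X * S = T * S - 1 := by
    rw [hTX]
    linear_combination hquad
  have hX0 : X ≠ 0 := by
    rintro rfl
    exact hS0 (by linear_combination hquad + (δ * S - 1) * hTXS)
  have hprod : a * X * (b * S) = δ / θ ^ 2 * (T * S - 1) := by
    rw [← hTXS]
    linear_combination X * S * hab
  have hprod' : a * X * (b * S) = (T * X - 1) / θ ^ 2 := by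
    rw [hprod, hTX]
    ring
  refine ⟨hS0, hX0, ?_, ?_⟩
  · have hbS : b * S ≠ 0 := mul_ne_zero hb0.ne' hS0
    have hdiv : (1 - ρ₁ * b * S) / (b * S) = 1 / (b * S) - ρ₁ := by
      field_simp
    rw [hdiv]
    apply mul_right_cancel₀ hbS
    have hinv : 1 / (b * S) * (b * S) = 1 := one_div_mul_cancel hbS
    linear_combination hprod - S * hab + b * S * ha + δ / θ ^ 2 * hinv
  · have haX : a * X ≠ 0 := mul_ne_zero ha0.ne' hX0
    have hdiv : (1 - ρ₂ * a * X) / (a * X) = 1 / (a * X) - ρ₂ := by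
      field_simp
    rw [hdiv]
    apply mul_right_cancel₀ haX
    have hinv : 1 / (a * X) * (a * X) = 1 := one_div_mul_cancel haX
    have hb' : b / δ = 1 + (1 + ρ₂) / θ ^ 2 := by
      rw [hb]
      field_simp
      ring
    have hab' : a * (b / δ) = T / θ ^ 2 := by
      rw [← mul_div_assoc, hab]
      field_simp
    linear_combination hprod' - X * hab' + a * X * hb' + 1 / θ ^ 2 * hinv
end

section
/- Let δ ∈ (0,1), θ > 0, ρ₁, ρ₂ > 0, w₁, w₂ ∈ (0,1), and m₁, m₂, S be real numbers. Define a := δ(1+ρ₁)/θ² + 1, b := δ(1+ρ₂)/θ² + δ, λ* := 1 + δ + θ² + δ/θ², T := ρ₂(1 + δ/θ²) + ρ₁(δ + δ/θ²) + ρ₁ρ₂·δ/θ² + λ*, and X := δ·S + (1−δ)/T. Assume: (i) δ·T·S² − (T + δ − 1)·S + 1 = 0; (ii) (1 − w₁)·(1 − ρ₁·b·S) = b·S; (iii) (1 − w₂)·(1 − ρ₂·a·X) = a·X; (iv) m₁·(ρ₁ + 1/(1−w₁)) = 1; (v) m₂·(ρ₂ + 1/(1−w₂)) = 1. Then w₁/(1−w₁)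 = (θ²/δ)·(1 − m₂) and w₂/(1−w₂) = θ²·(1 − m₁). -/
theorem stmt_6 (δ θ ρ₁ ρ₂ w₁ w₂ m₁ m₂ S : ℝ)
    (hδ : δ ∈ Set.Ioo (0 : ℝ) 1) (hθ : 0 < θ) (hρ₁ : 0 < ρ₁) (hρ₂ : 0 < ρ₂)
    (hw₁ : w₁ ∈ Set.Ioo (0 : ℝ) 1) (hw₂ : w₂ ∈ Set.Ioo (0 : ℝ) 1)
    (a b lamStar T X : ℝ)
    (ha : a = δ * (1 + ρ₁) / θ ^ 2 + 1)
    (hb : b = δ * (1 + ρ₂) / θ ^ 2 + δ)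
    (hlam : lamStar = 1 + δ + θ ^ 2 + δ / θ ^ 2)
    (hT : T = ρ₂ * (1 + δ / θ ^ 2) + ρ₁ * (δ + δ / θ ^ 2) + ρ₁ * ρ₂ * (δ / θ ^ 2) + lamStar)
    (hX : X = δ * S + (1 - δ) / T)
    (hquad : δ * T * S ^ 2 - (T + δ - 1) * S + 1 = 0)
    (hii : (1 - w₁) * (1 - ρ₁ * b * S) = b * S)
    (hiii : (1 - w₂) * (1 - ρ₂ * a * X) = a * X)
    (hiv : m₁ * (ρ₁ + 1 / (1 - w₁)) = 1)
    (hv : m₂ * (ρ₂ + 1 / (1 - w₂)) = 1) :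
    w₁ / (1 - w₁) = (θ ^ 2 / δ) * (1 - m₂) ∧
      w₂ / (1 - w₂) = θ ^ 2 * (1 - m₁) := by
  obtain ⟨hδ0, -⟩ := hδ
  have hδ' : δ ≠ 0 := hδ0.ne'
  have hθ' : θ ≠ 0 := hθ.ne'
  have h₁ : 1 - w₁ ≠ 0 := (sub_pos.2 hw₁.2).ne'
  have h₂ : 1 - w₂ ≠ 0 := (sub_pos.2 hw₂.2).ne'
  have hTpos : 0 < T := by rw [hT, hlam]; positivity
  have hab : θ ^ 2 * (a * b) = δ * T := by
    rw [ha, hb, hT, hlam]; field_simp; ring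
  have hTX : T * X = δ * T * S + (1 - δ) := by
    rw [hX]; field_simp [hTpos.ne']
  have hS : T * (S * (1 - X)) = 1 := by linear_combination -hquad - S * hTX
  have hXS : T * (X * (1 - δ * S)) = 1 := by
    linear_combination (1 - δ * S) * hTX - δ * hquad
  have ha' : θ ^ 2 * (a - 1) = δ * (1 + ρ₁) := by rw [ha]; field_simp; ring
  have hb' : θ ^ 2 * (b - δ) = δ * (1 + ρ₂) := by rw [hb]; field_simp; ring
  have hw₁u : w₁ / (1 - w₁) = 1 / (1 - w₁) - 1 := by field_simp; ring
  have hw₂u : w₂ / (1 - w₂) = 1 / (1 - w₂) - 1 := by field_simp; ring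
  have hbS : b * S * (ρ₁ + 1 / (1 - w₁)) = 1 := by
    field_simp; linear_combination -hii
  have haX : a * X * (ρ₂ + 1 / (1 - w₂)) = 1 := by
    field_simp; linear_combination -hiii
  have hm₁ : m₁ = b * S :=
    mul_right_cancel₀ (right_ne_zero_of_mul_eq_one hbS) (hiv.trans hbS.symm)
  have hm₂ : m₂ = a * X :=
    mul_right_cancel₀ (right_ne_zero_of_mul_eq_one haX) (hv.trans haX.symm)
  rw [hw₁u, hw₂u, hm₁, hm₂]
  generalize 1 / (1 - w₁) = u at *
  generalize 1 / (1 - w₂) = v at *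
  constructor
  · have key : δ * (ρ₁ + u) = θ ^ 2 * a * (1 - X) := by
      apply mul_left_cancel₀ (left_ne_zero_of_mul_eq_one hbS)
      linear_combination δ * hbS - S * (1 - X) * hab - δ * hS
    field_simp
    linear_combination key + ha'
  · have key : δ * (ρ₂ + v) = θ ^ 2 * b * (1 - δ * S) := by
      apply mul_left_cancel₀ (left_ne_zero_of_mul_eq_one haX)
      linear_combination δ * haX - X * (1 - δ * S) * hab - δ * hXS
    apply mul_left_cancel₀ hδ'
    linear_combination key + hb'
end

section
/- Let M, N ≥ 1, let W be a real M×N matrix, u ∈ ℝ^M, v ∈ ℝ^N, θ > 0, and define Y := (θ/√(M·N))·u·vᵀ + W. Let z > 0 be a real number such that z·I_M − W·Wᵀ is invertible (z is not an eigenvalue of WWᵀ) and det(z·I_M − Y·Yᵀ) = 0 (z is an eigenvalue of YYᵀ). Then z·I_N − Wᵀ·W is also invertible, and with S₁(z) := (z·I_M − W·Wᵀ)⁻¹ and S₂(z) := (z·I_N − Wᵀ·W)⁻¹ the empirical master equation holds: (1 − (θ/√(MN))·vᵀWᵀS₁(z)u)·(1 − (θ/√(MN))·uᵀW S₂(z)v)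 − z·((θ/M)·uᵀS₁(z)u)·((θ/N)·vᵀS₂(z)v) = 0. -/
open Matrix

section MasterEquation

variable {K m n : Type*} [Field K] [Fintype m] [DecidableEq m] [Fintype n] [DecidableEq n]

theorem smul_one_sub_mul_comm (A : Matrix m n K) (B : Matrix n m K) (z : K) :
    (z • (1 : Matrix n n K) - B * A) * B = B * (z • (1 : Matrix m m K) - A * B) := by
  simp [Matrix.sub_mul, Matrix.mul_sub, Matrix.mul_assoc]

theorem isUnit_smul_one_sub_mul_comm (A : Matrix m n K) (B : Matrix n m K) {z : K} (hz : z ≠ 0)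
    (h : IsUnit (z • (1 : Matrix m m K) - A * B)) :
    IsUnit (z • (1 : Matrix n n K) - B * A) := by
  have hdet := (isUnit_iff_isUnit_det _).mp h
  have hinv : (z • (1 : Matrix n n K) - B * A) *
      (z⁻¹ • (1 + B * (z • (1 : Matrix m m K) - A * B)⁻¹ * A)) = 1 := by
    rw [Matrix.mul_smul, Matrix.mul_add, ← Matrix.mul_assoc, ← Matrix.mul_assoc,
      smul_one_sub_mul_comm, Matrix.mul_assoc B, mul_nonsing_inv _ hdet, Matrix.mul_one,
      Matrix.mul_one, sub_add_cancel, smul_smul, inv_mul_cancel₀ hz, one_smul]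
  exact (isUnit_iff_isUnit_det _).mpr (isUnit_det_of_right_inverse hinv)

theorem inv_smul_one_sub_mul_comm (A : Matrix m n K) (B : Matrix n m K) {z : K} (hz : z ≠ 0)
    (h : IsUnit (z • (1 : Matrix m m K) - A * B)) :
    (z • (1 : Matrix n n K) - B * A)⁻¹ * B = B * (z • (1 : Matrix m m K) - A * B)⁻¹ := by
  have hm := (isUnit_iff_isUnit_det _).mp h
  have hn := (isUnit_iff_isUnit_det _).mp (isUnit_smul_one_sub_mul_comm A B hz h)
  calc (z • (1 : Matrix n n K) - B * A)⁻¹ * B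
      = (z • (1 : Matrix n n K) - B * A)⁻¹ *
          (B * (z • (1 : Matrix m m K) - A * B)) * (z • (1 : Matrix m m K) - A * B)⁻¹ := by
        rw [Matrix.mul_assoc, Matrix.mul_assoc B, mul_nonsing_inv _ hm, Matrix.mul_one]
    _ = B * (z • (1 : Matrix m m K) - A * B)⁻¹ := by
        rw [← smul_one_sub_mul_comm, ← Matrix.mul_assoc, nonsing_inv_mul _ hn, Matrix.one_mul]

theorem eq_inv_mulVec_of_mulVec_eq {A : Matrix m m K} (hA : IsUnit A) {x b : m → K}
    (h : A *ᵥ x = b) : x = A⁻¹ *ᵥ b := by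
  rw [← h, mulVec_mulVec, nonsing_inv_mul _ ((isUnit_iff_isUnit_det _).mp hA), one_mulVec]

/-- The master equation for a nonzero eigenvalue of the Gram matrix of a rank-one perturbation. -/
theorem master_equation_of_det_eq_zero (W : Matrix m n K) (u : m → K) (v : n → K) (c : K) {z : K}
    (hz : z ≠ 0) (hW : IsUnit (z • (1 : Matrix m m K) - W * Wᵀ))
    (hdet : (z • (1 : Matrix m m K) -
      (c • vecMulVec u v + W) * (c • vecMulVec u v + W)ᵀ).det = 0) :
    (1 - c * (v ⬝ᵥ ((Wᵀ * (z • (1 : Matrix m m K) - W * Wᵀ)⁻¹) *ᵥ u))) *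
        (1 - c * (u ⬝ᵥ ((W * (z • (1 : Matrix n n K) - Wᵀ * W)⁻¹) *ᵥ v))) -
      z * c ^ 2 * (u ⬝ᵥ ((z • (1 : Matrix m m K) - W * Wᵀ)⁻¹ *ᵥ u)) *
        (v ⬝ᵥ ((z • (1 : Matrix n n K) - Wᵀ * W)⁻¹ *ᵥ v)) = 0 := by
  have hW' := isUnit_smul_one_sub_mul_comm W Wᵀ hz hW
  have hcomm := inv_smul_one_sub_mul_comm W Wᵀ hz hW
  have hcomm' := inv_smul_one_sub_mul_comm Wᵀ W hz hW'
  obtain ⟨x, hx, hYx⟩ := exists_mulVec_eq_zero_iff.mpr hdet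
  obtain ⟨y, hy⟩ : ∃ y, y = (c • vecMulVec u v + W)ᵀ *ᵥ x := ⟨_, rfl⟩
  rw [sub_mulVec, ← mulVec_mulVec, ← hy, smul_mulVec, one_mulVec, add_mulVec, smul_mulVec,
    vecMulVec_mulVec, op_smul_eq_smul, smul_smul] at hYx
  rw [transpose_add, transpose_smul, transpose_vecMulVec, add_mulVec, smul_mulVec,
    vecMulVec_mulVec, op_smul_eq_smul, smul_smul] at hy
  obtain ⟨α, hα⟩ : ∃ α, α = c * (v ⬝ᵥ y) := ⟨_, rfl⟩
  obtain ⟨β, hβ⟩ : ∃ β, β = c * (u ⬝ᵥ x) := ⟨_, rfl⟩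
  rw [← hα] at hYx
  rw [← hβ] at hy
  have hWy : W *ᵥ y = z • x - α • u := by
    rw [eq_sub_iff_add_eq, add_comm]
    exact (sub_eq_zero.mp hYx).symm
  have hWx : Wᵀ *ᵥ x = y - β • v := by rw [hy, add_sub_cancel_left]
  have hx_eq : x = (z • (1 : Matrix m m K) - W * Wᵀ)⁻¹ *ᵥ (α • u + β • (W *ᵥ v)) := by
    apply eq_inv_mulVec_of_mulVec_eq hW
    rw [sub_mulVec, ← mulVec_mulVec, hWx, mulVec_sub, hWy, mulVec_smul, smul_mulVec, one_mulVec]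
    abel
  have hy_eq : y = (z • (1 : Matrix n n K) - Wᵀ * W)⁻¹ *ᵥ
      ((z * β) • v + α • (Wᵀ *ᵥ u)) := by
    apply eq_inv_mulVec_of_mulVec_eq hW'
    rw [sub_mulVec, ← mulVec_mulVec, hWy, mulVec_sub, mulVec_smul, mulVec_smul, hWx, smul_mulVec,
      one_mulVec, smul_sub, smul_smul]
    abel
  have hne : α ≠ 0 ∨ β ≠ 0 := by
    by_contra! h
    exact hx (by rw [hx_eq, h.1, h.2]; simp)
  have hux := congrArg (u ⬝ᵥ ·) hx_eq
  have hvy := congrArg (v ⬝ᵥ ·) hy_eq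
  simp only [mulVec_add, mulVec_smul, mulVec_mulVec, hcomm, hcomm', dotProduct_add,
    dotProduct_smul, smul_eq_mul] at hux hvy
  rw [hux] at hβ
  rw [hvy] at hα
  generalize v ⬝ᵥ ((Wᵀ * (z • (1 : Matrix m m K) - W * Wᵀ)⁻¹) *ᵥ u) = a at *
  generalize u ⬝ᵥ ((W * (z • (1 : Matrix n n K) - Wᵀ * W)⁻¹) *ᵥ v) = b at *
  generalize u ⬝ᵥ ((z • (1 : Matrix m m K) - W * Wᵀ)⁻¹ *ᵥ u) = p at *
  generalize v ⬝ᵥ ((z • (1 : Matrix n n K) - Wᵀ * W)⁻¹ *ᵥ v) = q at *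
  rcases hne with h | h
  · refine (mul_eq_zero.mp ?_).resolve_left h
    linear_combination (1 - c * b) * hα + c * z * q * hβ
  · refine (mul_eq_zero.mp ?_).resolve_left h
    linear_combination (1 - c * a) * hβ + c * p * hα

end MasterEquation

theorem stmt_8 (M N : ℕ) (hM : 1 ≤ M) (hN : 1 ≤ N)
    (W : Matrix (Fin M) (Fin N) ℝ) (u : Fin M → ℝ) (v : Fin N → ℝ)
    (θ : ℝ) (hθ : 0 < θ)
    (Y : Matrix (Fin M) (Fin N) ℝ)
    (hY : Y = (θ / Real.sqrt ((M : ℝ) * (N : ℝ))) • Matrix.vecMulVec u v + W)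
    (z : ℝ) (hz : 0 < z)
    (hW : IsUnit (z • (1 : Matrix (Fin M) (Fin M) ℝ) - W * Wᵀ))
    (hYz : (z • (1 : Matrix (Fin M) (Fin M) ℝ) - Y * Yᵀ).det = 0) :
    IsUnit (z • (1 : Matrix (Fin N) (Fin N) ℝ) - Wᵀ * W) ∧
      (1 - θ / Real.sqrt ((M : ℝ) * (N : ℝ)) *
          (v ⬝ᵥ ((Wᵀ * (z • (1 : Matrix (Fin M) (Fin M) ℝ) - W * Wᵀ)⁻¹) *ᵥ u))) *
        (1 - θ / Real.sqrt ((M : ℝ) * (N : ℝ)) *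
          (u ⬝ᵥ ((W * (z • (1 : Matrix (Fin N) (Fin N) ℝ) - Wᵀ * W)⁻¹) *ᵥ v))) -
      z * (θ / (M : ℝ) * (u ⬝ᵥ ((z • (1 : Matrix (Fin M) (Fin M) ℝ) - W * Wᵀ)⁻¹ *ᵥ u))) *
        (θ / (N : ℝ) * (v ⬝ᵥ ((z • (1 : Matrix (Fin N) (Fin N) ℝ) - Wᵀ * W)⁻¹ *ᵥ v))) = 0 := by
  subst hY
  refine ⟨isUnit_smul_one_sub_mul_comm W Wᵀ hz.ne' hW, ?_⟩
  have hc : (θ / Real.sqrt ((M : ℝ) * (N : ℝ))) ^ 2 = θ / M * (θ / N) := by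
    rw [div_pow, Real.sq_sqrt (by positivity), div_mul_div_comm, sq]
  have h := master_equation_of_det_eq_zero W u v _ hz.ne' hW hYz
  rw [hc] at h
  linear_combination h
end

section
/- Let M, N ≥ 1, let W be a real M×N matrix, u* ∈ ℝ^M, v* ∈ ℝ^N, θ > 0, and define Y := (θ/√(M·N))·u*·v*ᵀ + W. Let σ ∈ ℝ with σ ≠ 0, and let u ∈ ℝ^M, v ∈ ℝ^N satisfy Y·v = σ·u and Yᵀ·u = σ·v. Assume σ²·I_M − W·Wᵀ and σ²·I_N − Wᵀ·W are invertible. Then u = (σ²·I_M − W·Wᵀ)⁻¹ · ( (θ·⟨u,u*⟩/√(MN))·(W·v*) + (θ·σ·⟨v,v*⟩/√(MN))·u* ) and v = (σ²·I_N − Wᵀ·W)⁻¹ · ( (θ·⟨v,v*⟩/√(MN))·(Wᵀ·u*) + (θ·σ·⟨u,u*⟩/√(MN))·v* ). -/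
open Matrix

/-- If `σ u = a x + W v` and `σ v = b y + Wᵀ u`, eliminating `v` expresses `u` through the resolvent
of `W Wᵀ` at `σ ^ 2`. -/
theorem eq_resolvent_mulVec_of_coupled {m n : Type*} [Fintype m] [DecidableEq m] [Fintype n]
    {R : Type*} [CommRing R] (W : Matrix m n R) (σ a b : R) (u x : m → R) (v y : n → R)
    (hu : σ • u = a • x + W *ᵥ v) (hv : σ • v = b • y + Wᵀ *ᵥ u)
    (hinv : IsUnit (σ ^ 2 • (1 : Matrix m m R) - W * Wᵀ)) :
    u = (σ ^ 2 • (1 : Matrix m m R) - W * Wᵀ)⁻¹ *ᵥ (b • (W *ᵥ y) + (σ * a) • x) := by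
  have key : (σ ^ 2 • (1 : Matrix m m R) - W * Wᵀ) *ᵥ u = b • (W *ᵥ y) + (σ * a) • x := by
    have hWv : σ • (W *ᵥ v) = b • (W *ᵥ y) + W *ᵥ (Wᵀ *ᵥ u) := by
      rw [← mulVec_smul, hv, mulVec_add, mulVec_smul]
    rw [sub_mulVec, smul_mulVec, one_mulVec, ← mulVec_mulVec, pow_two, mul_smul, hu, smul_add,
      hWv, smul_smul]
    abel
  rw [← key, mulVec_mulVec, nonsing_inv_mul _ ((isUnit_iff_isUnit_det _).mp hinv), one_mulVec]

theorem stmt_9 (M N : ℕ) (hM : 1 ≤ M) (hN : 1 ≤ N)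
    (W : Matrix (Fin M) (Fin N) ℝ) (uStar : Fin M → ℝ) (vStar : Fin N → ℝ)
    (θ : ℝ) (hθ : 0 < θ)
    (Y : Matrix (Fin M) (Fin N) ℝ)
    (hY : Y = (θ / Real.sqrt ((M : ℝ) * (N : ℝ))) • Matrix.vecMulVec uStar vStar + W)
    (σ : ℝ) (hσ : σ ≠ 0) (u : Fin M → ℝ) (v : Fin N → ℝ)
    (huv : Y *ᵥ v = σ • u) (hvu : Yᵀ *ᵥ u = σ • v)
    (hinv₁ : IsUnit (σ ^ 2 • (1 : Matrix (Fin M) (Fin M) ℝ) - W * Wᵀ))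
    (hinv₂ : IsUnit (σ ^ 2 • (1 : Matrix (Fin N) (Fin N) ℝ) - Wᵀ * W)) :
    u = (σ ^ 2 • (1 : Matrix (Fin M) (Fin M) ℝ) - W * Wᵀ)⁻¹ *ᵥ
        ((θ * (u ⬝ᵥ uStar) / Real.sqrt ((M : ℝ) * (N : ℝ))) • (W *ᵥ vStar) +
          (θ * σ * (v ⬝ᵥ vStar) / Real.sqrt ((M : ℝ) * (N : ℝ))) • uStar) ∧
      v = (σ ^ 2 • (1 : Matrix (Fin N) (Fin N) ℝ) - Wᵀ * W)⁻¹ *ᵥ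
        ((θ * (v ⬝ᵥ vStar) / Real.sqrt ((M : ℝ) * (N : ℝ))) • (Wᵀ *ᵥ uStar) +
          (θ * σ * (u ⬝ᵥ uStar) / Real.sqrt ((M : ℝ) * (N : ℝ))) • vStar) := by
  subst hY
  have hu : σ • u = (θ / Real.sqrt ((M : ℝ) * (N : ℝ)) * (v ⬝ᵥ vStar)) • uStar + W *ᵥ v := by
    rw [← huv, add_mulVec, smul_mulVec, vecMulVec_mulVec, op_smul_eq_smul, smul_smul,
      dotProduct_comm]
  have hv : σ • v = (θ / Real.sqrt ((M : ℝ) * (N : ℝ)) * (u ⬝ᵥ uStar)) • vStar + Wᵀ *ᵥ u := by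
    rw [← hvu, transpose_add, transpose_smul, transpose_vecMulVec, add_mulVec, smul_mulVec,
      vecMulVec_mulVec, op_smul_eq_smul, smul_smul, dotProduct_comm]
  constructor
  · convert eq_resolvent_mulVec_of_coupled W σ _ _ u uStar v vStar hu hv hinv₁ using 4 <;> ring
  · have h := eq_resolvent_mulVec_of_coupled Wᵀ σ _ _ v vStar u uStar hv
      (by rwa [transpose_transpose]) (by rwa [transpose_transpose])
    rw [transpose_transpose] at h
    convert h using 4 <;> ring
end

section
/- Let K ≥ 1, fix r ∈ Fin K, and let γ : Fin K → ℝ satisfy 0 < γ(k) for every k and ∑_k γ(k)² < 1. For a sign vector s : Fin K → ℝ with s(k) ∈ {−1, 1} for all k and s(r) = 1, write γ_s(k) := s(k)·γ(k). On a probability space, let U be a real random variable with E[U²] = 1 whose law is NOT the standard Gaussian N(0,1), and for each such sign vector s let Z_s be an ℝ^K-valued random vector, independent of U, with characteristic function E[exp(i⟨w, Z_s⟩)] = exp(−(‖w‖² − ⟨w, γ_s⟩²)/2) for all w ∈ ℝ^K. Then for any two sign vectors s ≠ t (both taking the value 1 at r), the laws of X_s := γ_s·U + Z_s and X_t := γ_t·U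 + Z_t on ℝ^K are different. -/
open MeasureTheory ProbabilityTheory

/-- The characteristic function of `c U + Z` factors when `U` and `Z` are independent. -/
lemma integral_cexp_smul_add_eq_charFun_mul {Ω ι : Type*} [MeasurableSpace Ω] [Fintype ι]
    (μ : Measure Ω) {U : Ω → ℝ} {Z : Ω → ι → ℝ} (hU : Measurable U) (hZ : Measurable Z)
    (hind : IndepFun U Z μ) (c w : ι → ℝ) :
    ∫ x, Complex.exp (Complex.I * ((∑ k, w k * x k : ℝ) : ℂ))
        ∂(Measure.map (fun ω k => c k * U ω + Z ω k) μ)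
      = charFun (Measure.map U μ) (∑ k, w k * c k) *
        ∫ ω, Complex.exp (Complex.I * ((∑ k, w k * Z ω k : ℝ) : ℂ)) ∂μ := by
  have hX : Measurable (fun ω k => c k * U ω + Z ω k) := by fun_prop
  rw [integral_map hX.aemeasurable
      (Measurable.aestronglyMeasurable (by fun_prop)), charFun_apply_real,
    integral_map hU.aemeasurable (Measurable.aestronglyMeasurable (by fun_prop))]
  have hcomp : IndepFun
      (fun ω => Complex.exp (((∑ k, w k * c k : ℝ) : ℂ) * (U ω : ℂ) * Complex.I))
      (fun ω => Complex.exp (Complex.I * ((∑ k, w k * Z ω k : ℝ) : ℂ))) μ :=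
    hind.comp
      (φ := fun u : ℝ => Complex.exp (((∑ k, w k * c k : ℝ) : ℂ) * (u : ℂ) * Complex.I))
      (ψ := fun z : ι → ℝ => Complex.exp (Complex.I * ((∑ k, w k * z k : ℝ) : ℂ)))
      (by fun_prop) (by fun_prop)
  rw [← hcomp.integral_fun_mul_eq_mul_integral
    (Measurable.aestronglyMeasurable (by fun_prop))
    (Measurable.aestronglyMeasurable (by fun_prop))]
  refine integral_congr_ae (Filter.Eventually.of_forall fun ω => ?_)
  have hsum : ∑ k, w k * (c k * U ω + Z ω k)
      = (∑ k, w k * c k) * U ω + ∑ k, w k * Z ω k := by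
    rw [Finset.sum_mul, ← Finset.sum_add_distrib]
    exact Finset.sum_congr rfl fun k _ => by ring
  simp only [hsum, ← Complex.exp_add]
  congr 1
  push_cast
  ring

/-- Two sign patterns that agree at one index and differ at another are separated by a vector
orthogonal to the second one. -/
lemma exists_sum_mul_sign_mul_eq {ι : Type*} [Fintype ι] [DecidableEq ι] {γ s t : ι → ℝ}
    (hγ : ∀ k, γ k ≠ 0) (hs : ∀ k, s k = 1 ∨ s k = -1) (ht : ∀ k, t k = 1 ∨ t k = -1)
    {r : ι} (hsr : s r = 1) (htr : t r = 1) (hst : s ≠ t) (x : ℝ) :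
    ∃ w : ι → ℝ, ∑ k, w k * (s k * γ k) = x ∧ ∑ k, w k * (t k * γ k) = 0 := by
  obtain ⟨j, hj⟩ := Function.ne_iff.mp hst
  have hr := hγ r
  have hj' := hγ j
  refine ⟨Pi.single r (x / (2 * γ r)) + Pi.single j (s j * x / (2 * γ j)), ?_, ?_⟩
  all_goals
    simp only [Pi.add_apply, add_mul, Finset.sum_add_distrib, Pi.single_apply, ite_mul, zero_mul,
      Finset.sum_ite_eq', Finset.mem_univ, if_true, hsr, htr]
    rcases hs j with h | h <;> rcases ht j with h' | h' <;>
      first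
      | exact absurd (h.trans h'.symm) hj
      | (rw [h]; try rw [h']
         field_simp
         ring)

theorem stmt_12 {Ω : Type*} [MeasurableSpace Ω] (Pr : Measure Ω) [IsProbabilityMeasure Pr]
    (K : ℕ) (hK : 1 ≤ K) (r : Fin K) (γ : Fin K → ℝ)
    (hγpos : ∀ k, 0 < γ k) (hγ : ∑ k, (γ k) ^ 2 < 1)
    (U : Ω → ℝ) (hU : Measurable U) (hU2 : ∫ ω, (U ω) ^ 2 ∂Pr = 1)
    (hUlaw : Measure.map U Pr ≠ gaussianReal 0 1)
    (s t : Fin K → ℝ) (hs : ∀ k, s k = 1 ∨ s k = -1) (ht : ∀ k, t k = 1 ∨ t k = -1)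
    (hsr : s r = 1) (htr : t r = 1) (hst : s ≠ t)
    (Zs Zt : Ω → (Fin K → ℝ)) (hZs : Measurable Zs) (hZt : Measurable Zt)
    (hindS : IndepFun U Zs Pr) (hindT : IndepFun U Zt Pr)
    (hZsChar : ∀ w : Fin K → ℝ,
      ∫ ω, Complex.exp (Complex.I * ((∑ k, w k * Zs ω k : ℝ) : ℂ)) ∂Pr
        = Complex.exp (-((((∑ k, (w k) ^ 2) - (∑ k, w k * (s k * γ k)) ^ 2) / 2 : ℝ) : ℂ)))
    (hZtChar : ∀ w : Fin K → ℝ,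
      ∫ ω, Complex.exp (Complex.I * ((∑ k, w k * Zt ω k : ℝ) : ℂ)) ∂Pr
        = Complex.exp (-((((∑ k, (w k) ^ 2) - (∑ k, w k * (t k * γ k)) ^ 2) / 2 : ℝ) : ℂ))) :
    Measure.map (fun ω => fun k => s k * γ k * U ω + Zs ω k) Pr ≠
      Measure.map (fun ω => fun k => t k * γ k * U ω + Zt ω k) Pr := by
  intro hlaw
  refine hUlaw ?_
  have : IsProbabilityMeasure (Measure.map U Pr) :=
    Measure.isProbabilityMeasure_map hU.aemeasurable
  refine Measure.ext_of_charFun (funext fun x => ?_)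
  obtain ⟨w, hws, hwt⟩ :=
    exists_sum_mul_sign_mul_eq (fun k => (hγpos k).ne') hs ht hsr htr hst x
  have hS := integral_cexp_smul_add_eq_charFun_mul Pr hU hZs hindS (fun k => s k * γ k) w
  have hT := integral_cexp_smul_add_eq_charFun_mul Pr hU hZt hindT (fun k => t k * γ k) w
  rw [hlaw, hT, hZsChar, hZtChar, hws, hwt, charFun_zero] at hS
  rw [charFun_gaussianReal]
  refine mul_right_cancel₀ (Complex.exp_ne_zero _) (hS.symm.trans ?_)
  rw [probReal_univ, Complex.ofReal_one, one_mul, ← Complex.exp_add]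
  congr 1
  push_cast
  ring
end

section
/- Let k be an even natural number. Let γ_r, γ_j ∈ (0,1) with γ_r² + γ_j² ≤ 1, let s_r, s_j ∈ {−1, 1}, and set γ̃_r := √(1 − γ_r²), γ̃_j := √(1 − γ_j²) and ρ₀ := −s_r·s_j·γ_r·γ_j/(γ̃_r·γ̃_j). On a probability space, let U be a real random variable with E[|U|^{k+2}] < ∞ satisfying E[U^{2ℓ}] = (2ℓ−1)!! for every natural ℓ with 1 ≤ ℓ ≤ k/2, and let (Z_r, Z_j) be a pair of real random variables, independent of U, with characteristic function E[exp(i(w₁Z_r + w₂Z_j))] = exp(−(w₁² + 2ρ₀w₁w₂ + w₂²)/2) for all (w₁, w₂) ∈ ℝ² (i.e., centered bivariate Gaussian with unit variances and correlation ρ₀). Then E[(s_rγ_rU + γ̃_rZ_r)^{k+1}·(s_jγ_jU + γ̃_jZ_j)] = s_r·s_j·γ_r^{k+1}·γ_j·(E[U^{k+2}] − (k+1)!!). -/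
open MeasureTheory ProbabilityTheory

/-- The law of a pair of real random variables is determined by its joint characteristic
function. -/
lemma map_prodMk_eq_of_charFun_eq {Ω Ω' : Type*} [MeasurableSpace Ω] [MeasurableSpace Ω']
    {P : Measure Ω} {P' : Measure Ω'} [IsFiniteMeasure P] [IsFiniteMeasure P']
    {X Y : Ω → ℝ} {X' Y' : Ω' → ℝ} (hX : Measurable X) (hY : Measurable Y)
    (hX' : Measurable X') (hY' : Measurable Y')
    (h : ∀ s t : ℝ, ∫ ω, Complex.exp (Complex.I * ((s * X ω + t * Y ω : ℝ) : ℂ)) ∂P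
      = ∫ ω, Complex.exp (Complex.I * ((s * X' ω + t * Y' ω : ℝ) : ℂ)) ∂P') :
    P.map (fun ω => (X ω, Y ω)) = P'.map (fun ω => (X' ω, Y' ω)) := by
  apply Measure.ext_of_charFunDual
  ext L
  have hL (x y : ℝ) : L (x, y) = L (1, 0) * x + L (0, 1) * y := by
    have hxy : ((x, y) : ℝ × ℝ) = x • (1, 0) + y • (0, 1) := by simp
    rw [hxy, map_add, map_smul, map_smul]
    simp [mul_comm]
  rw [charFunDual_apply, charFunDual_apply, integral_map (by fun_prop) (by fun_prop),
    integral_map (by fun_prop) (by fun_prop)]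
  have hchar := h (L (1, 0)) (L (0, 1))
  simp_rw [← hL, mul_comm Complex.I] at hchar
  exact hchar

/-- The moments `E[X ^ p * Y ^ q]` of a pair of real random variables are determined by its joint
characteristic function. -/
lemma integral_pow_mul_pow_eq_of_charFun_eq {Ω : Type*} [MeasurableSpace Ω]
    {P : Measure Ω} [IsFiniteMeasure P] {X Y X' Y' : Ω → ℝ}
    (hX : Measurable X) (hY : Measurable Y) (hX' : Measurable X') (hY' : Measurable Y')
    (h : ∀ s t : ℝ, ∫ ω, Complex.exp (Complex.I * ((s * X ω + t * Y ω : ℝ) : ℂ)) ∂P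
      = ∫ ω, Complex.exp (Complex.I * ((s * X' ω + t * Y' ω : ℝ) : ℂ)) ∂P) (p q : ℕ) :
    ∫ ω, X ω ^ p * Y ω ^ q ∂P = ∫ ω, X' ω ^ p * Y' ω ^ q ∂P := by
  have hmap := map_prodMk_eq_of_charFun_eq hX hY hX' hY' h
  have h₁ := integral_map (μ := P) (φ := fun ω => (X ω, Y ω)) (by fun_prop)
    (f := fun z : ℝ × ℝ => z.1 ^ p * z.2 ^ q) (by fun_prop)
  have h₂ := integral_map (μ := P) (φ := fun ω => (X' ω, Y' ω)) (by fun_prop)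
    (f := fun z : ℝ × ℝ => z.1 ^ p * z.2 ^ q) (by fun_prop)
  rw [← h₁, ← h₂, hmap]

lemma map_eq_gaussianReal_of_charFun {Ω : Type*} [MeasurableSpace Ω] {P : Measure Ω}
    [IsFiniteMeasure P] {X : Ω → ℝ} (hX : Measurable X)
    (h : ∀ t : ℝ, ∫ ω, Complex.exp (Complex.I * ((t * X ω : ℝ) : ℂ)) ∂P
      = Complex.exp (-((t ^ 2 / 2 : ℝ) : ℂ))) :
    P.map X = gaussianReal 0 1 := by
  apply Measure.ext_of_charFun
  ext t
  rw [charFun_apply_real, charFun_gaussianReal, integral_map (by fun_prop) (by fun_prop)]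
  convert h t using 1
  · congr! 3
    push_cast
    ring
  · congr 1
    push_cast
    ring

lemma integrable_pow_gaussianReal (n : ℕ) :
    Integrable (fun x : ℝ => x ^ n) (gaussianReal 0 1) := by
  rcases eq_or_ne n 0 with rfl | hn
  · simp
  · have h := (memLp_id_gaussianReal (μ := 0) (v := 1) n).integrable_norm_pow
      (by exact_mod_cast hn)
    refine h.mono' (by fun_prop) (.of_forall fun x => ?_)
    simp

lemma integral_exp_gaussianReal (t : ℝ) :
    ∫ x, Complex.exp (Complex.I * ((t * x : ℝ) : ℂ)) ∂(gaussianReal 0 1)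
      = Complex.exp (-((t ^ 2 / 2 : ℝ) : ℂ)) := by
  have h := charFun_gaussianReal (μ := 0) (v := 1) t
  rw [charFun_apply_real] at h
  convert h using 1
  · congr! 3
    push_cast
    ring
  · congr 1
    push_cast
    ring

/-- The even moments of the standard Gaussian are double factorials. -/
lemma integral_pow_two_mul_gaussianReal (l : ℕ) :
    ∫ x, x ^ (2 * l) ∂(gaussianReal 0 1) = (Nat.doubleFactorial (2 * l - 1) : ℝ) := by
  rw [integral_gaussianReal_eq_integral_smul one_ne_zero]
  have h₁ : ∀ x : ℝ, gaussianPDFReal 0 1 x • x ^ (2 * l)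
      = (√(2 * Real.pi))⁻¹ * (|x| ^ (2 * l) * Real.exp (-(1 / 2) * |x| ^ 2)) := by
    intro x
    rw [(even_two_mul l).pow_abs, sq_abs, gaussianPDFReal_def]
    simp only [smul_eq_mul, NNReal.coe_one, mul_one, sub_zero]
    rw [show -x ^ 2 / 2 = -(1 / 2) * x ^ 2 by ring]
    ring
  have h₂ := integral_rpow_mul_exp_neg_mul_rpow (p := 2) (q := ((2 * l : ℕ) : ℝ)) (b := 1 / 2)
    (by norm_num) (by linarith [(2 * l : ℕ).cast_nonneg (α := ℝ)]) (by norm_num)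
  simp only [Real.rpow_natCast, Real.rpow_ofNat] at h₂
  simp_rw [h₁]
  rw [integral_const_mul,
    integral_comp_abs (f := fun x => x ^ (2 * l) * Real.exp (-(1 / 2) * x ^ 2)), h₂]
  have h₃ : (((2 * l : ℕ) : ℝ) + 1) / 2 = l + 1 / 2 := by push_cast; ring
  have h₄ : ((1 : ℝ) / 2) ^ (-(((2 * l : ℕ) : ℝ) + 1) / 2) = 2 ^ l * √2 := by
    rw [neg_div, h₃, one_div, Real.inv_rpow (by norm_num), Real.rpow_neg (by norm_num), inv_inv,
      Real.rpow_add (by norm_num), Real.rpow_natCast, ← one_div, Real.sqrt_eq_rpow]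
  rw [h₄, h₃, Real.Gamma_nat_add_half, Real.sqrt_mul (by norm_num)]
  have : √Real.pi ≠ 0 := (Real.sqrt_pos.2 Real.pi_pos).ne'
  field_simp

/-- Binomial expansion of a mixed moment of linear combinations of `U` and `(X, Y)`, where `U` is
independent of `(X, Y)`. -/
lemma integral_pow_mul_linear_combination {Ω : Type*} [MeasurableSpace Ω] {P : Measure Ω}
    {U X Y : Ω → ℝ} (hU : Measurable U) (hX : Measurable X) (hY : Measurable Y) {N : ℕ}
    (hUint : ∀ n ≤ N + 1, Integrable (fun ω => U ω ^ n) P)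
    (hXYint : ∀ p q : ℕ, Integrable (fun ω => X ω ^ p * Y ω ^ q) P)
    (hind : IndepFun U (fun ω => (X ω, Y ω)) P) (a b α β : ℝ) :
    ∫ ω, (a * U ω + α * X ω) ^ N * (b * U ω + β * Y ω) ∂P
      = ∑ m ∈ Finset.range (N + 1), (a ^ m * α ^ (N - m) * N.choose m) *
          (b * ((∫ ω, U ω ^ (m + 1) ∂P) * ∫ ω, X ω ^ (N - m) * Y ω ^ 0 ∂P) +
            β * ((∫ ω, U ω ^ m ∂P) * ∫ ω, X ω ^ (N - m) * Y ω ^ 1 ∂P)) := by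
  have hindep (n p q : ℕ) :
      IndepFun (fun ω => U ω ^ n) (fun ω => X ω ^ p * Y ω ^ q) P :=
    hind.comp (φ := fun x => x ^ n) (ψ := fun z : ℝ × ℝ => z.1 ^ p * z.2 ^ q)
      (by fun_prop) (by fun_prop)
  have hint (n p q : ℕ) (hn : n ≤ N + 1) :
      Integrable (fun ω => U ω ^ n * (X ω ^ p * Y ω ^ q)) P :=
    (hindep n p q).integrable_mul (hUint n hn) (hXYint p q)
  have hmul (n p q : ℕ) : ∫ ω, U ω ^ n * (X ω ^ p * Y ω ^ q) ∂P
      = (∫ ω, U ω ^ n ∂P) * ∫ ω, X ω ^ p * Y ω ^ q ∂P :=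
    (hindep n p q).integral_fun_mul_eq_mul_integral (by fun_prop) (by fun_prop)
  have hexp (ω : Ω) : (a * U ω + α * X ω) ^ N * (b * U ω + β * Y ω)
      = ∑ m ∈ Finset.range (N + 1), (a ^ m * α ^ (N - m) * N.choose m) *
          (b * (U ω ^ (m + 1) * (X ω ^ (N - m) * Y ω ^ 0)) +
            β * (U ω ^ m * (X ω ^ (N - m) * Y ω ^ 1))) := by
    rw [add_pow, Finset.sum_mul]
    refine Finset.sum_congr rfl fun m _ => ?_
    ring
  simp_rw [hexp]
  have hint₁ (m : ℕ) (hm : m ∈ Finset.range (N + 1)) :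
      Integrable (fun ω => b * (U ω ^ (m + 1) * (X ω ^ (N - m) * Y ω ^ 0))) P :=
    (hint _ _ _ (by have := Finset.mem_range.1 hm; omega)).const_mul b
  have hint₂ (m : ℕ) (hm : m ∈ Finset.range (N + 1)) :
      Integrable (fun ω => β * (U ω ^ m * (X ω ^ (N - m) * Y ω ^ 1))) P :=
    (hint _ _ _ (by have := Finset.mem_range.1 hm; omega)).const_mul β
  rw [integral_finsetSum _ fun m hm => ((hint₁ m hm).fun_add (hint₂ m hm)).const_mul _]
  refine Finset.sum_congr rfl fun m hm => ?_
  rw [integral_const_mul, integral_add (hint₁ m hm) (hint₂ m hm), integral_const_mul,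
    integral_const_mul, hmul, hmul]

/-- If `U` is standard Gaussian, independent of `(X, Y)`, and the joint law of the two linear
combinations is standard Gaussian, then the mixed moment vanishes. -/
lemma integral_prod_gaussianReal_pow_mul_eq_zero {Ω : Type*} [MeasurableSpace Ω] {P : Measure Ω}
    [IsProbabilityMeasure P] {X Y : Ω → ℝ} (hX : Measurable X) (hY : Measurable Y)
    {a b α β ρ : ℝ} (haα : a ^ 2 + α ^ 2 = 1) (hbβ : b ^ 2 + β ^ 2 = 1)
    (hab : a * b + α * β * ρ = 0)
    (hchar : ∀ s t : ℝ, ∫ ω, Complex.exp (Complex.I * ((s * X ω + t * Y ω : ℝ) : ℂ)) ∂P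
      = Complex.exp (-(((s ^ 2 + 2 * ρ * s * t + t ^ 2) / 2 : ℝ) : ℂ))) (N : ℕ) :
    ∫ z, (a * z.1 + α * X z.2) ^ N * (b * z.1 + β * Y z.2) ∂((gaussianReal 0 1).prod P) = 0 := by
  have hjoint (s t : ℝ) : ∫ z, Complex.exp (Complex.I *
        ((s * (a * z.1 + α * X z.2) + t * (b * z.1 + β * Y z.2) : ℝ) : ℂ))
          ∂((gaussianReal 0 1).prod P)
      = Complex.exp (-(((s ^ 2 + t ^ 2) / 2 : ℝ) : ℂ)) := by
    have hsplit (z : ℝ × Ω) : Complex.exp (Complex.I *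
        ((s * (a * z.1 + α * X z.2) + t * (b * z.1 + β * Y z.2) : ℝ) : ℂ))
        = Complex.exp (Complex.I * (((a * s + b * t) * z.1 : ℝ) : ℂ)) *
          Complex.exp (Complex.I * (((α * s) * X z.2 + (β * t) * Y z.2 : ℝ) : ℂ)) := by
      rw [← Complex.exp_add]
      congr 1
      push_cast
      ring
    simp_rw [hsplit]
    rw [integral_prod_mul (fun x : ℝ => Complex.exp (Complex.I * (((a * s + b * t) * x : ℝ) : ℂ)))
      (fun ω => Complex.exp (Complex.I * (((α * s) * X ω + (β * t) * Y ω : ℝ) : ℂ))),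
      integral_exp_gaussianReal, hchar, ← Complex.exp_add, ← Complex.ofReal_neg,
      ← Complex.ofReal_neg, ← Complex.ofReal_neg, ← Complex.ofReal_add]
    congr 2
    linear_combination (-s ^ 2 / 2) * haα - t ^ 2 / 2 * hbβ - s * t * hab
  have hsymm := integral_pow_mul_pow_eq_of_charFun_eq (P := (gaussianReal 0 1).prod P)
    (X := fun z => a * z.1 + α * X z.2) (Y := fun z => b * z.1 + β * Y z.2)
    (X' := fun z => a * z.1 + α * X z.2) (Y' := fun z => -(b * z.1 + β * Y z.2))
    (by fun_prop) (by fun_prop) (by fun_prop) (by fun_prop)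
    (fun s t => by
      have h := hjoint s (-t)
      simp_rw [neg_mul_comm] at h
      rw [hjoint, h, neg_sq]) N 1
  simp only [pow_one, mul_neg, integral_neg] at hsymm
  linarith

theorem stmt_13 {Ω : Type*} [MeasurableSpace Ω] (Pr : Measure Ω) [IsProbabilityMeasure Pr]
    (k : ℕ) (hk : Even k)
    (γr γj : ℝ) (hγr : γr ∈ Set.Ioo (0 : ℝ) 1) (hγj : γj ∈ Set.Ioo (0 : ℝ) 1)
    (hγsum : γr ^ 2 + γj ^ 2 ≤ 1)
    (sr sj : ℝ) (hsr : sr = 1 ∨ sr = -1) (hsj : sj = 1 ∨ sj = -1)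
    (γtr γtj ρ₀ : ℝ)
    (hγtr : γtr = Real.sqrt (1 - γr ^ 2)) (hγtj : γtj = Real.sqrt (1 - γj ^ 2))
    (hρ₀ : ρ₀ = -(sr * sj * γr * γj) / (γtr * γtj))
    (U Zr Zj : Ω → ℝ) (hU : Measurable U) (hZr : Measurable Zr) (hZj : Measurable Zj)
    (hUint : Integrable (fun ω => |U ω| ^ (k + 2)) Pr)
    (hmom : ∀ ℓ : ℕ, 1 ≤ ℓ → ℓ ≤ k / 2 →
      ∫ ω, (U ω) ^ (2 * ℓ) ∂Pr = (Nat.doubleFactorial (2 * ℓ - 1) : ℝ))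
    (hind : IndepFun U (fun ω => (Zr ω, Zj ω)) Pr)
    (hZchar : ∀ w₁ w₂ : ℝ,
      ∫ ω, Complex.exp (Complex.I * ((w₁ * Zr ω + w₂ * Zj ω : ℝ) : ℂ)) ∂Pr
        = Complex.exp (-(((w₁ ^ 2 + 2 * ρ₀ * w₁ * w₂ + w₂ ^ 2) / 2 : ℝ) : ℂ))) :
    ∫ ω, (sr * γr * U ω + γtr * Zr ω) ^ (k + 1) * (sj * γj * U ω + γtj * Zj ω) ∂Pr
      = sr * sj * γr ^ (k + 1) * γj *
          ((∫ ω, (U ω) ^ (k + 2) ∂Pr) - (Nat.doubleFactorial (k + 1) : ℝ)) := by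
  obtain ⟨hγr0, hγr1⟩ := hγr
  obtain ⟨hγj0, hγj1⟩ := hγj
  have hr : 0 < 1 - γr ^ 2 := by nlinarith
  have hj : 0 < 1 - γj ^ 2 := by nlinarith
  have hγtr_pos : 0 < γtr := hγtr ▸ Real.sqrt_pos.2 hr
  have hγtj_pos : 0 < γtj := hγtj ▸ Real.sqrt_pos.2 hj
  have hγtr_sq : γtr ^ 2 = 1 - γr ^ 2 := by rw [hγtr, Real.sq_sqrt hr.le]
  have hγtj_sq : γtj ^ 2 = 1 - γj ^ 2 := by rw [hγtj, Real.sq_sqrt hj.le]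
  have hsr_sq : sr ^ 2 = 1 := by rcases hsr with rfl | rfl <;> norm_num
  have hsj_sq : sj ^ 2 = 1 := by rcases hsj with rfl | rfl <;> norm_num
  have hsr_pow : sr ^ (k + 1) = sr := by
    obtain ⟨l, rfl⟩ := hk
    rw [← two_mul, pow_succ, pow_mul, hsr_sq, one_pow, one_mul]
  have hmapr : Pr.map Zr = gaussianReal 0 1 :=
    map_eq_gaussianReal_of_charFun hZr fun t => by simpa using hZchar t 0
  have hmapj : Pr.map Zj = gaussianReal 0 1 :=
    map_eq_gaussianReal_of_charFun hZj fun t => by simpa using hZchar 0 t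
  have hZr_int (n : ℕ) : Integrable (fun ω => Zr ω ^ n) Pr :=
    (hmapr ▸ integrable_pow_gaussianReal n : Integrable (fun x : ℝ => x ^ n) (Pr.map Zr))
      |>.comp_measurable hZr
  have hZj_int (n : ℕ) : Integrable (fun ω => Zj ω ^ n) Pr :=
    (hmapj ▸ integrable_pow_gaussianReal n : Integrable (fun x : ℝ => x ^ n) (Pr.map Zj))
      |>.comp_measurable hZj
  have hZ_int (p q : ℕ) : Integrable (fun ω => Zr ω ^ p * Zj ω ^ q) Pr := by
    refine ((hZr_int (p * 2)).add (hZj_int (q * 2))).mono' (by fun_prop) (.of_forall fun ω => ?_)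
    simp only [Pi.add_apply, pow_mul, Real.norm_eq_abs]
    rw [abs_le]
    constructor <;>
      nlinarith [sq_nonneg (Zr ω ^ p + Zj ω ^ q), sq_nonneg (Zr ω ^ p - Zj ω ^ q),
        sq_nonneg (Zr ω ^ p), sq_nonneg (Zj ω ^ q)]
  have hU_int (n : ℕ) (hn : n ≤ k + 1 + 1) : Integrable (fun ω => U ω ^ n) Pr := by
    refine ((integrable_const (1 : ℝ)).add hUint).mono' (by fun_prop) (.of_forall fun ω => ?_)
    simp only [Pi.add_apply, norm_pow, Real.norm_eq_abs]
    rcases le_total |U ω| 1 with h | h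
    · linarith [pow_le_one₀ (n := n) (abs_nonneg _) h, pow_nonneg (abs_nonneg (U ω)) (k + 2)]
    · linarith [pow_le_pow_right₀ h hn]
  have hZ_odd (p q : ℕ) (hpq : Odd (p + q)) : ∫ ω, Zr ω ^ p * Zj ω ^ q ∂Pr = 0 := by
    have h := integral_pow_mul_pow_eq_of_charFun_eq hZr hZj hZr.neg hZj.neg (P := Pr)
      (fun s t => by
        have h := hZchar (-s) (-t)
        simp_rw [neg_mul_comm] at h
        simp only [Pi.neg_apply]
        rw [hZchar, h]
        congr 4
        ring) p q
    have hneg (x y : ℝ) : (-x) ^ p * (-y) ^ q = -(x ^ p * y ^ q) := by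
      rw [neg_pow x, neg_pow y, mul_mul_mul_comm, ← pow_add, hpq.neg_one_pow, neg_one_mul]
    simp only [Pi.neg_apply, hneg, integral_neg] at h
    linarith
  have hmoment (n p q : ℕ) (hn : n < k + 2) (hnpq : n + p + q = k + 2) :
      (∫ ω, U ω ^ n ∂Pr) * ∫ ω, Zr ω ^ p * Zj ω ^ q ∂Pr
        = (∫ x, x ^ n ∂(gaussianReal 0 1)) * ∫ ω, Zr ω ^ p * Zj ω ^ q ∂Pr := by
    rcases Nat.even_or_odd n with he | ho
    · congr 1
      obtain ⟨l, rfl⟩ := he.two_dvd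
      rcases Nat.eq_zero_or_pos l with rfl | hl
      · simp
      · rw [hmom l hl (by obtain ⟨j, rfl⟩ := hk; omega), integral_pow_two_mul_gaussianReal]
    · rw [hZ_odd p q (by grind), mul_zero, mul_zero]
  have hgauss := integral_prod_gaussianReal_pow_mul_eq_zero hZr hZj
    (a := sr * γr) (b := sj * γj) (α := γtr) (β := γtj) (ρ := ρ₀)
    (by rw [mul_pow, hsr_sq, hγtr_sq]; ring) (by rw [mul_pow, hsj_sq, hγtj_sq]; ring)
    (by rw [hρ₀]; field_simp; ring) hZchar (k + 1)
  have hsnd : MeasurePreserving Prod.snd ((gaussianReal 0 1).prod Pr) Pr := measurePreserving_snd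
  have hfst : MeasurePreserving Prod.fst ((gaussianReal 0 1).prod Pr) (gaussianReal 0 1) :=
    measurePreserving_fst
  have hfst_integral (n : ℕ) : ∫ z, z.1 ^ n ∂((gaussianReal 0 1).prod Pr)
      = ∫ x, x ^ n ∂(gaussianReal 0 1) := by
    simpa using integral_fun_fst (μ := gaussianReal 0 1) (ν := Pr) fun x : ℝ => x ^ n
  have hsnd_integral (p q : ℕ) : ∫ z, Zr z.2 ^ p * Zj z.2 ^ q ∂((gaussianReal 0 1).prod Pr)
      = ∫ ω, Zr ω ^ p * Zj ω ^ q ∂Pr := by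
    simpa using integral_fun_snd (μ := gaussianReal 0 1) (ν := Pr) fun ω => Zr ω ^ p * Zj ω ^ q
  rw [integral_pow_mul_linear_combination (P := (gaussianReal 0 1).prod Pr) (U := Prod.fst)
    (X := fun z => Zr z.2) (Y := fun z => Zj z.2) (by fun_prop) (by fun_prop) (by fun_prop)
    (fun n _ => hfst.integrable_comp_of_integrable (integrable_pow_gaussianReal n))
    (fun p q => hsnd.integrable_comp_of_integrable (hZ_int p q))
    (indepFun_prod measurable_id (hZr.prodMk hZj))] at hgauss
  simp only [hfst_integral, hsnd_integral] at hgauss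
  rw [← sub_zero (∫ ω, _ ∂Pr), ← hgauss,
    integral_pow_mul_linear_combination hU hZr hZj hU_int hZ_int hind,
    ← Finset.sum_sub_distrib, Finset.sum_range_succ, Finset.sum_eq_zero]
  · have hk2 : ∫ x, x ^ (k + 1 + 1) ∂(gaussianReal 0 1) = (Nat.doubleFactorial (k + 1) : ℝ) := by
      obtain ⟨l, rfl⟩ := hk
      rw [show l + l + 1 + 1 = 2 * (l + 1) by ring, integral_pow_two_mul_gaussianReal]
      congr 2
      omega
    rw [hk2, hmoment (k + 1) (k + 1 - (k + 1)) 1 (by omega) (by omega), mul_pow, hsr_pow]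
    simp
    ring
  · intro m hm
    have hm' := Finset.mem_range.1 hm
    rw [hmoment (m + 1) (k + 1 - m) 0 (by omega) (by omega),
      hmoment m (k + 1 - m) 1 (by omega) (by omega), sub_self]
end

section
/- Let (α, 𝒜, μ) be a finite measure space, let a, b : α → ℝ be measurable functions with a(x) > 0 and b(x) > 0 for all x, let ρ > 0, and define D(x) := ρ·b(x) + a(x). Then (∫ b²/D² dμ) · (∫ a/D dμ) ≥ (∫ a·b/D² dμ) · (∫ b/D dμ). -/
open MeasureTheory

theorem sq_integral_le_measureReal_univ_mul_integral_sq {α : Type*} [MeasurableSpace α]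
    {μ : Measure α} [IsFiniteMeasure μ] {f : α → ℝ} (hf : MemLp f 2 μ) :
    (∫ x, f x ∂μ) ^ 2 ≤ μ.real Set.univ * ∫ x, f x ^ 2 ∂μ := by
  have hf1 : Integrable f μ := hf.integrable one_le_two
  have hlin : ∀ t : ℝ, Integrable (fun x => t * t + (-2 * t) * f x) μ := fun t =>
    (integrable_const _).add (hf1.const_mul _)
  have key : ∀ t : ℝ, 0 ≤ μ.real Set.univ * (t * t) + (-2 * ∫ x, f x ∂μ) * t
      + ∫ x, f x ^ 2 ∂μ := by
    intro t
    calc (0 : ℝ) ≤ ∫ x, (f x - t) ^ 2 ∂μ := integral_nonneg fun x => sq_nonneg _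
      _ = ∫ x, (t * t + (-2 * t) * f x + f x ^ 2) ∂μ := by
        congr 1 with x
        ring
      _ = _ := by
        rw [integral_add (hlin t) hf.integrable_sq,
          integral_add (integrable_const _) (hf1.const_mul _), integral_const,
          integral_const_mul, smul_eq_mul]
        ring
  have h := discrim_le_zero key
  rw [discrim] at h
  linarith

theorem stmt_17 {α : Type*} [MeasurableSpace α] (μ : Measure α) [IsFiniteMeasure μ]
    (a b : α → ℝ) (ha : Measurable a) (hb : Measurable b)
    (hap : ∀ x, 0 < a x) (hbp : ∀ x, 0 < b x)
    (ρ : ℝ) (hρ : 0 < ρ) (D : α → ℝ) (hD : ∀ x, D x = ρ * b x + a x) :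
    (∫ x, a x * b x / (D x) ^ 2 ∂μ) * (∫ x, b x / D x ∂μ) ≤
      (∫ x, (b x) ^ 2 / (D x) ^ 2 ∂μ) * (∫ x, a x / D x ∂μ) := by
  have hDpos : ∀ x, 0 < D x := fun x => by
    rw [hD]
    exact add_pos (mul_pos hρ (hbp x)) (hap x)
  have hDm : Measurable D := by
    rw [funext hD]
    fun_prop
  -- With `u = b / D`, we have `a / D = 1 - ρ u`, and the claim reduces to Cauchy-Schwarz for `u`.
  set u : α → ℝ := fun x => b x / D x with hu
  have hu2 : MemLp u 2 μ := by
    refine MemLp.of_bound (hb.div hDm).aestronglyMeasurable (1 / ρ) (ae_of_all _ fun x => ?_)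
    rw [Real.norm_of_nonneg (div_pos (hbp x) (hDpos x)).le, div_le_div_iff₀ (hDpos x) hρ, hD]
    linarith [hap x]
  have hu1 : Integrable u μ := hu2.integrable one_le_two
  have hv : ∀ x, a x / D x = 1 - ρ * u x := fun x => by
    have := (hDpos x).ne'
    simp only [hu]
    field_simp
    linarith [hD x]
  have huv : ∀ x, a x * b x / D x ^ 2 = u x - ρ * u x ^ 2 := fun x => by
    calc a x * b x / D x ^ 2 = (a x / D x) * u x := by
          simp only [hu]
          ring
      _ = u x - ρ * u x ^ 2 := by
          rw [hv]
          ring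
  have hsq : ∀ x, b x ^ 2 / D x ^ 2 = u x ^ 2 := fun x => (div_pow _ _ _).symm
  simp_rw [huv, hsq, hv]
  rw [integral_sub hu1 (hu2.integrable_sq.const_mul ρ),
    integral_sub (integrable_const _) (hu1.const_mul ρ), integral_const_mul, integral_const_mul,
    integral_const, smul_eq_mul]
  linarith [sq_integral_le_measureReal_univ_mul_integral_sq hu2]
end
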